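/- Let h : ℝ²×ℝ → ℂ be a Schwartz function and Q(t,ξ) = (t/(4π)) ∫_{S²} h((ξ,0)+tη) dS(η) its planar photoacoustic data, defined for all (t,ξ) ∈ ℝ×ℝ². Then for every Schwartz function g : ℝ×ℝ² → ℂ with g(ω,σ) = 0 whenever |ω| ≥ ‖σ‖, one has ∫_{ℝ×ℝ²} Q(t,ξ) · ( (2π)^{−3/2} ∫_{ℝ×ℝ²} g(ω,σ) e^{i(ωt + σ·ξ)} dω dσ ) dt dξ = 0, the outer integral being absolutely convergent. In other words, the Fourier transform of the tempered distribution Q is supported in the cone {(ω,σ) ∈ ℝ×ℝ² : |ω| ≥ ‖σ‖}. -/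

import Mathlib

open MeasureTheory Real Complex
open scoped RealInnerProductSpace

/-- Embedding of `ℝ² × ℝ` into `ℝ³` (Euclidean). -/
noncomputable def emb (ξ : EuclideanSpace ℝ (Fin 2)) (r : ℝ) : EuclideanSpace ℝ (Fin 3) :=
  (EuclideanSpace.equiv (Fin 3) ℝ).symm ![ξ 0, ξ 1, r]

/-- Planar photoacoustic data `Q(t,ξ) = (t/(4π)) ∫_{S²} h((ξ,0)+tη) dS(η)`,
where `dS` is the surface measure on the unit sphere of `ℝ³`. -/
noncomputable def Q (h : EuclideanSpace ℝ (Fin 3) → ℂ) (t : ℝ)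
    (ξ : EuclideanSpace ℝ (Fin 2)) : ℂ :=
  ((t / (4 * π) : ℝ) : ℂ) * ∫ η : Metric.sphere (0 : EuclideanSpace ℝ (Fin 3)) 1,
    h (emb ξ 0 + t • (η : EuclideanSpace ℝ (Fin 3)))
    ∂((volume : Measure (EuclideanSpace ℝ (Fin 3))).toSphere)



theorem gauss_half (n : ℕ) :
    ∫ x in Set.Ioi (0 : ℝ), x ^ n * Real.exp (-x ^ 2) = (1 / 2) * Real.Gamma (((n : ℝ) + 1) / 2) := by
  have := _root_.integral_rpow_mul_exp_neg_rpow (p := 2) (q := n) (by norm_num)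
    (by have : (0 : ℝ) ≤ n := by positivity
        linarith)
  rw [← this]
  refine setIntegral_congr_fun measurableSet_Ioi fun x hx => ?_
  simp

theorem gauss_even (m : ℕ) :
    ∫ x : ℝ, x ^ (2 * m) * Real.exp (-x ^ 2) = Real.Gamma ((((2 * m : ℕ) : ℝ) + 1) / 2) := by
  have := integral_comp_abs (f := fun x : ℝ => x ^ (2 * m) * Real.exp (-x ^ 2))
  rw [gauss_half] at this
  simp only [pow_mul, sq_abs] at this ⊢
  rw [this]; ring

theorem gauss_odd (m : ℕ) :
    ∫ x : ℝ, x ^ (2 * m + 1) * Real.exp (-x ^ 2) = 0 := by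
  have := integral_neg_eq_self (fun x : ℝ => x ^ (2 * m + 1) * Real.exp (-x ^ 2)) volume
  have h2 : ∀ x : ℝ, (-x) ^ (2 * m + 1) * Real.exp (-(-x) ^ 2)
      = -(x ^ (2 * m + 1) * Real.exp (-x ^ 2)) := by
    intro x
    rw [Odd.neg_pow ⟨m, rfl⟩]; simp
  simp only [h2, integral_neg] at this
  linarith

theorem gauss_prod (n : ℕ) :
    ∫ x : (EuclideanSpace ℝ (Fin 3)), (x 0) ^ n * Real.exp (-‖x‖ ^ 2) = (∫ x : ℝ, x ^ n * Real.exp (-x ^ 2)) * π := by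
  rw [← (PiLp.volume_preserving_toLp (Fin 3)).integral_comp
    (MeasurableEquiv.toLp 2 (Fin 3 → ℝ)).measurableEmbedding]
  have h1 : ∀ x : Fin 3 → ℝ, ((WithLp.toLp 2 x : (EuclideanSpace ℝ (Fin 3))) 0) ^ n * Real.exp (-‖(WithLp.toLp 2 x : (EuclideanSpace ℝ (Fin 3)))‖ ^ 2)
      = ∏ i : Fin 3, (![fun y : ℝ => y ^ n * Real.exp (-y ^ 2), fun y : ℝ => Real.exp (-y ^ 2),
        fun y : ℝ => Real.exp (-y ^ 2)] i) (x i) := by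
    intro x
    rw [EuclideanSpace.norm_sq_eq]
    simp [Fin.sum_univ_three, Fin.prod_univ_three, Real.exp_add]
    ring
  simp_rw [h1]
  rw [integral_fintype_prod_volume_eq_prod]
  have := integral_gaussian 1
  simp only [neg_mul, one_mul, div_one] at this
  simp [Fin.prod_univ_three, this]
  rw [mul_assoc, Real.mul_self_sqrt Real.pi_pos.le]

theorem gauss_rot (w : (EuclideanSpace ℝ (Fin 3))) (n : ℕ) :
    ∫ x : (EuclideanSpace ℝ (Fin 3)), (⟪w, x⟫ : ℝ) ^ n * Real.exp (-‖x‖ ^ 2)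
      = ‖w‖ ^ n * ((∫ x : ℝ, x ^ n * Real.exp (-x ^ 2)) * π) := by
  set v : (EuclideanSpace ℝ (Fin 3)) := ‖w‖ • EuclideanSpace.single 0 1 with hv
  have hn : ‖w‖ = ‖v‖ := by simp [hv, norm_smul]
  set A := Submodule.reflection (Submodule.span ℝ {w - v})ᗮ with hA
  have hAw : A w = v := Submodule.reflection_sub hn
  rw [← A.symm.measurePreserving.integral_comp A.symm.toHomeomorph.measurableEmbedding, ← gauss_prod,
    ← integral_const_mul]
  refine integral_congr_ae (Filter.Eventually.of_forall fun x => ?_)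
  have : (⟪w, A.symm x⟫ : ℝ) = ‖w‖ * x 0 := by
    rw [← A.inner_map_map, hAw, A.apply_symm_apply, hv, inner_smul_left]
    simp [EuclideanSpace.inner_single_left]
  simp only [this, LinearIsometryEquiv.norm_map]
  ring

theorem sphere_polar (w : (EuclideanSpace ℝ (Fin 3))) (n : ℕ) :
    ∫ x : (EuclideanSpace ℝ (Fin 3)), (⟪w, x⟫ : ℝ) ^ n * Real.exp (-‖x‖ ^ 2)
      = (∫ η : (Metric.sphere (0 : EuclideanSpace ℝ (Fin 3)) 1), (⟪w, (η : (EuclideanSpace ℝ (Fin 3)))⟫ : ℝ) ^ n ∂(volume : Measure (EuclideanSpace ℝ (Fin 3))).toSphere) *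
        ∫ r in Set.Ioi (0 : ℝ), r ^ (n + 2) * Real.exp (-r ^ 2) := by
  calc
    _ = ∫ x : ({(0)}ᶜ : Set (EuclideanSpace ℝ (Fin 3))), (⟪w, x.1⟫ : ℝ) ^ n * Real.exp (-‖x.1‖ ^ 2)
        ∂((volume : Measure (EuclideanSpace ℝ (Fin 3))).comap (↑)) := by
      rw [integral_subtype_comap (measurableSet_singleton _).compl
        fun x : (EuclideanSpace ℝ (Fin 3)) ↦ (⟪w, x⟫ : ℝ) ^ n * Real.exp (-‖x‖ ^ 2), restrict_compl_singleton]
    _ = ∫ x : (Metric.sphere (0 : EuclideanSpace ℝ (Fin 3)) 1) × Set.Ioi (0 : ℝ), (⟪w, (x.1 : (EuclideanSpace ℝ (Fin 3)))⟫ : ℝ) ^ n *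
          ((x.2 : ℝ) ^ n * Real.exp (-(x.2 : ℝ) ^ 2))
        ∂(volume : Measure (EuclideanSpace ℝ (Fin 3))).toSphere.prod (.volumeIoiPow (Module.finrank ℝ (EuclideanSpace ℝ (Fin 3)) - 1)) := by
      rw [← (volume : Measure (EuclideanSpace ℝ (Fin 3))).measurePreserving_homeomorphUnitSphereProd.integral_comp
        (Homeomorph.measurableEmbedding _)]
      refine integral_congr_ae (Filter.Eventually.of_forall fun x => ?_)
      have hx : ‖x.1‖ ≠ 0 := norm_ne_zero_iff.2 x.2
      simp [inner_smul_right]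
      rw [← mul_assoc, ← mul_pow]
      field_simp
    _ = _ := by
      rw [integral_prod_mul (fun η : (Metric.sphere (0 : EuclideanSpace ℝ (Fin 3)) 1) => (⟪w, (η : (EuclideanSpace ℝ (Fin 3)))⟫ : ℝ) ^ n)
        (fun r : Set.Ioi (0 : ℝ) => (r : ℝ) ^ n * Real.exp (-(r : ℝ) ^ 2))]
      congr 1
      simp only [Measure.volumeIoiPow, ENNReal.ofReal]
      rw [integral_withDensity_eq_integral_smul,
        integral_subtype_comap measurableSet_Ioi fun a : ℝ ↦
          Real.toNNReal (a ^ (Module.finrank ℝ (EuclideanSpace ℝ (Fin 3)) - 1)) • (a ^ n * Real.exp (-a ^ 2)),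
        setIntegral_congr_fun measurableSet_Ioi fun x hx ↦ ?_]
      · rw [NNReal.smul_def, Real.coe_toNNReal _ (pow_nonneg (le_of_lt hx) _)]
        simp
        ring
      · exact (measurable_subtype_coe.pow_const _).real_toNNReal

theorem gamma_half_pos (n : ℕ) : 0 < Real.Gamma (((n : ℝ) + 1) / 2) :=
  Real.Gamma_pos_of_pos (by positivity)

theorem gauss_shift (n : ℕ) :
    ∫ x in Set.Ioi (0 : ℝ), x ^ (n + 2) * Real.exp (-x ^ 2)
      = ((n : ℝ) + 1) / 4 * Real.Gamma (((n : ℝ) + 1) / 2) := by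
  rw [gauss_half]
  have : (((n + 2 : ℕ) : ℝ) + 1) / 2 = ((n : ℝ) + 1) / 2 + 1 := by push_cast; ring
  rw [this, Real.Gamma_add_one (by positivity)]
  ring

theorem moment_even (w : (EuclideanSpace ℝ (Fin 3))) (m : ℕ) :
    ∫ η : (Metric.sphere (0 : EuclideanSpace ℝ (Fin 3)) 1), (⟪w, (η : (EuclideanSpace ℝ (Fin 3)))⟫ : ℝ) ^ (2 * m) ∂(volume : Measure (EuclideanSpace ℝ (Fin 3))).toSphere
      = 4 * π * ‖w‖ ^ (2 * m) / (2 * m + 1) := by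
  have h := sphere_polar w (2 * m)
  rw [gauss_rot, gauss_shift, gauss_even] at h
  have := gamma_half_pos (2 * m)
  push_cast at this h
  rw [eq_div_iff (by positivity)]
  apply mul_right_cancel₀ this.ne'
  linarith

theorem moment_odd (w : (EuclideanSpace ℝ (Fin 3))) (m : ℕ) :
    ∫ η : (Metric.sphere (0 : EuclideanSpace ℝ (Fin 3)) 1), (⟪w, (η : (EuclideanSpace ℝ (Fin 3)))⟫ : ℝ) ^ (2 * m + 1) ∂(volume : Measure (EuclideanSpace ℝ (Fin 3))).toSphere = 0 := by
  have h := sphere_polar w (2 * m + 1)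
  rw [gauss_rot, gauss_shift, gauss_odd] at h
  have := gamma_half_pos (2 * m + 1)
  rw [zero_mul, mul_zero, eq_comm, mul_eq_zero] at h
  exact h.resolve_right (by positivity)

theorem sphere_exp (w : (EuclideanSpace ℝ (Fin 3))) :
    ∫ η : (Metric.sphere (0 : EuclideanSpace ℝ (Fin 3)) 1), Complex.exp (((⟪w, (η : (EuclideanSpace ℝ (Fin 3)))⟫ : ℝ) : ℂ) * Complex.I) ∂(volume : Measure (EuclideanSpace ℝ (Fin 3))).toSphere
      = ((4 * π * Real.sinc ‖w‖ : ℝ) : ℂ) := by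
  by_cases hw : w = 0
  · have := moment_even w 0
    simp at this
    simp [hw, this]
  have hw' : ‖w‖ ≠ 0 := norm_ne_zero_iff.2 hw
  set F : ℕ → (Metric.sphere (0 : EuclideanSpace ℝ (Fin 3)) 1) → ℂ := fun n η => ((((⟪w, (η : (EuclideanSpace ℝ (Fin 3)))⟫ : ℝ) : ℂ) * Complex.I)) ^ n / (n.factorial : ℂ) with hF
  have hcont : ∀ n, Continuous (F n) := by
    intro n
    simp only [hF]
    fun_prop
  have hbound : ∀ n η, ‖F n η‖ ≤ ‖w‖ ^ n / n.factorial := by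
    intro n η
    simp only [hF, norm_div, norm_pow, norm_mul, Complex.norm_real, Complex.norm_I, mul_one,
      Complex.norm_natCast]
    gcongr
    have := norm_inner_le_norm (𝕜 := ℝ) w (η : (EuclideanSpace ℝ (Fin 3)))
    simpa using this
  have hint : ∀ n, Integrable (F n) (volume : Measure (EuclideanSpace ℝ (Fin 3))).toSphere := fun n =>
    Integrable.of_bound (hcont n).aestronglyMeasurable _ (Filter.Eventually.of_forall (hbound n))
  have hsum : Summable fun n => ∫ η, ‖F n η‖ ∂(volume : Measure (EuclideanSpace ℝ (Fin 3))).toSphere := by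
    refine Summable.of_nonneg_of_le (fun n => integral_nonneg fun _ => norm_nonneg _)
      (fun n => ?_) ((Real.summable_pow_div_factorial ‖w‖).mul_right
        ((volume : Measure (EuclideanSpace ℝ (Fin 3))).toSphere.real Set.univ))
    calc _ ≤ ∫ η : (Metric.sphere (0 : EuclideanSpace ℝ (Fin 3)) 1), ‖w‖ ^ n / n.factorial ∂(volume : Measure (EuclideanSpace ℝ (Fin 3))).toSphere :=
          integral_mono (hint n).norm (integrable_const _) (hbound n)
      _ = _ := by rw [integral_const, smul_eq_mul, mul_comm]
  have key := hasSum_integral_of_summable_integral_norm hint hsum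
  have h1 : ∀ η : (Metric.sphere (0 : EuclideanSpace ℝ (Fin 3)) 1), ∑' n, F n η = Complex.exp (((⟪w, (η : (EuclideanSpace ℝ (Fin 3)))⟫ : ℝ) : ℂ) * Complex.I) := by
    intro η
    rw [Complex.exp_eq_exp_ℂ, NormedSpace.exp_eq_tsum_div]
  simp_rw [h1] at key
  have hval : ∀ n, ∫ η, F n η ∂(volume : Measure (EuclideanSpace ℝ (Fin 3))).toSphere
      = ((∫ η : (Metric.sphere (0 : EuclideanSpace ℝ (Fin 3)) 1), (⟪w, (η : (EuclideanSpace ℝ (Fin 3)))⟫ : ℝ) ^ n ∂(volume : Measure (EuclideanSpace ℝ (Fin 3))).toSphere : ℝ) : ℂ) *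
        (Complex.I ^ n / (n.factorial : ℂ)) := by
    intro n
    rw [← integral_complex_ofReal, ← integral_mul_const]
    refine integral_congr_ae (Filter.Eventually.of_forall fun x => ?_)
    simp only [hF, mul_pow]
    push_cast
    ring
  simp_rw [hval] at key
  rw [← (mul_right_injective₀ (two_ne_zero' ℕ)).hasSum_iff] at key
  swap
  · intro n hn
    rcases Nat.even_or_odd' n with ⟨m, rfl | rfl⟩
    · exact absurd ⟨m, rfl⟩ hn
    · rw [moment_odd]; simp
  refine key.unique ?_
  have h2 := ((Complex.hasSum_sin (‖w‖ : ℂ)).mul_left (4 * π / ‖w‖ : ℂ))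
  rw [Real.sinc_of_ne_zero hw']
  convert! h2 using 1
  · funext m
    simp only [Function.comp, moment_even]
    simp only [pow_mul, Complex.I_sq, Nat.factorial_succ]
    have : (‖w‖ : ℂ) ≠ 0 := by exact_mod_cast hw'
    have h3 : ((2 * m + 1 : ℕ) : ℂ) ≠ 0 := by exact_mod_cast Nat.succ_ne_zero (2 * m)
    push_cast at h3 ⊢
    field_simp
    ring
  · push_cast; ring

open scoped FourierTransform

/-- The (unnormalised) inverse Fourier transform of `g` in the variables `(t, ξ)`. -/
noncomputable def GG (g : SchwartzMap (ℝ × (EuclideanSpace ℝ (Fin 2))) ℂ) (p : ℝ × (EuclideanSpace ℝ (Fin 2))) : ℂ :=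
  ∫ q : ℝ × (EuclideanSpace ℝ (Fin 2)), g q * Complex.exp (Complex.I * ((q.1 * p.1 + ⟪q.2, p.2⟫ : ℝ) : ℂ))


/-- `g` transported to the Hilbert space product. -/
noncomputable def gV (g : SchwartzMap (ℝ × (EuclideanSpace ℝ (Fin 2))) ℂ) : SchwartzMap (WithLp 2 (ℝ × EuclideanSpace ℝ (Fin 2))) ℂ :=
  SchwartzMap.compCLMOfContinuousLinearEquiv ℝ (WithLp.prodContinuousLinearEquiv 2 ℝ ℝ (EuclideanSpace ℝ (Fin 2))) g

theorem gV_apply (g : SchwartzMap (ℝ × (EuclideanSpace ℝ (Fin 2))) ℂ) (v : (WithLp 2 (ℝ × EuclideanSpace ℝ (Fin 2)))) : gV g v = g (WithLp.ofLp v) := rfl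

theorem integral_VV (f : (WithLp 2 (ℝ × EuclideanSpace ℝ (Fin 2))) → ℂ) : ∫ p : ℝ × (EuclideanSpace ℝ (Fin 2)), f (WithLp.toLp 2 p) = ∫ v, f v :=
  (WithLp.volume_preserving_toLp ℝ (EuclideanSpace ℝ (Fin 2))).integral_comp
    (MeasurableEquiv.toLp 2 (ℝ × (EuclideanSpace ℝ (Fin 2)))).measurableEmbedding f

theorem GG_eq (g : SchwartzMap (ℝ × (EuclideanSpace ℝ (Fin 2))) ℂ) (p : ℝ × (EuclideanSpace ℝ (Fin 2))) :
    GG g p = (𝓕⁻ (gV g)) ((2 * π)⁻¹ • (WithLp.toLp 2 p : (WithLp 2 (ℝ × EuclideanSpace ℝ (Fin 2))))) := by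
  rw [SchwartzMap.fourierInv_coe, Real.fourierInv_eq', ← integral_VV, GG]
  refine integral_congr_ae (Filter.Eventually.of_forall fun q => ?_)
  simp only [gV_apply, WithLp.prod_inner_apply, inner_smul_right, smul_eq_mul]
  rw [mul_comm]
  congr 2
  rw [mul_comm]
  congr 2
  have : π ≠ 0 := Real.pi_ne_zero
  simp
  field_simp

theorem GG_schwartz (g : SchwartzMap (ℝ × (EuclideanSpace ℝ (Fin 2))) ℂ) :
    ∃ G : SchwartzMap (ℝ × (EuclideanSpace ℝ (Fin 2))) ℂ, ∀ p, GG g p = G p := by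
  refine ⟨SchwartzMap.compCLMOfContinuousLinearEquiv ℝ
    ((WithLp.prodContinuousLinearEquiv 2 ℝ ℝ (EuclideanSpace ℝ (Fin 2))).symm.trans
      (ContinuousLinearEquiv.smulLeft (Units.mk0 ((2 * π)⁻¹ : ℝ) (by positivity)))) (𝓕⁻ (gV g)),
      fun p => ?_⟩
  rw [GG_eq]
  rfl

theorem GG_vanish (g : SchwartzMap (ℝ × (EuclideanSpace ℝ (Fin 2))) ℂ) (ω : ℝ) (σ : (EuclideanSpace ℝ (Fin 2))) :
    ∫ p : ℝ × (EuclideanSpace ℝ (Fin 2)), Complex.exp (((ω * p.1 + ⟪σ, p.2⟫ : ℝ) : ℂ) * Complex.I) * GG g p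
      = ((2 * π) ^ 3 : ℝ) * g (-ω, -σ) := by
  set κ : (WithLp 2 (ℝ × EuclideanSpace ℝ (Fin 2))) := WithLp.toLp 2 (ω, σ) with hκ
  have hpi : π ≠ 0 := Real.pi_ne_zero
  have h1 : ∀ p : ℝ × (EuclideanSpace ℝ (Fin 2)), Complex.exp (((ω * p.1 + ⟪σ, p.2⟫ : ℝ) : ℂ) * Complex.I) * GG g p
      = (fun v : (WithLp 2 (ℝ × EuclideanSpace ℝ (Fin 2))) => Complex.exp (((2 * π * ⟪v, κ⟫ : ℝ) : ℂ) * Complex.I) *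
        (𝓕⁻ (gV g) : SchwartzMap (WithLp 2 (ℝ × EuclideanSpace ℝ (Fin 2))) ℂ) v) ((2 * π)⁻¹ • WithLp.toLp 2 p) := by
    intro p
    rw [GG_eq]
    simp only [inner_smul_left, hκ, WithLp.prod_inner_apply]
    congr 4
    rw [real_inner_comm σ]
    simp
    field_simp
  rw [integral_congr_ae (Filter.Eventually.of_forall h1),
    integral_VV (fun v : (WithLp 2 (ℝ × EuclideanSpace ℝ (Fin 2))) => (fun v : (WithLp 2 (ℝ × EuclideanSpace ℝ (Fin 2))) => Complex.exp (((2 * π * ⟪v, κ⟫ : ℝ) : ℂ) * Complex.I) *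
        (𝓕⁻ (gV g) : SchwartzMap (WithLp 2 (ℝ × EuclideanSpace ℝ (Fin 2))) ℂ) v) ((2 * π)⁻¹ • v)), 
    Measure.integral_comp_inv_smul (volume : Measure (WithLp 2 (ℝ × EuclideanSpace ℝ (Fin 2)))) (fun v : (WithLp 2 (ℝ × EuclideanSpace ℝ (Fin 2))) =>
      Complex.exp (((2 * π * ⟪v, κ⟫ : ℝ) : ℂ) * Complex.I) *
        (𝓕⁻ (gV g) : SchwartzMap (WithLp 2 (ℝ × EuclideanSpace ℝ (Fin 2))) ℂ) v) (2 * π)]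
  have hfin : Module.finrank ℝ (WithLp 2 (ℝ × EuclideanSpace ℝ (Fin 2))) = 3 := by
    rw [LinearEquiv.finrank_eq (WithLp.linearEquiv 2 ℝ (ℝ × (EuclideanSpace ℝ (Fin 2))))]
    simp
  have h2 : ∫ v : (WithLp 2 (ℝ × EuclideanSpace ℝ (Fin 2))), Complex.exp (((2 * π * ⟪v, κ⟫ : ℝ) : ℂ) * Complex.I) * (𝓕⁻ (gV g) : SchwartzMap (WithLp 2 (ℝ × EuclideanSpace ℝ (Fin 2))) ℂ) v
      = g (-ω, -σ) := by
    have h3 : (𝓕 (𝓕⁻ (gV g))) (-κ) = gV g (-κ) := by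
      rw [FourierTransform.fourier_fourierInv_eq]
    rw [SchwartzMap.fourier_coe, Real.fourier_eq', gV_apply] at h3
    rw [show g (-ω, -σ) = g (WithLp.ofLp (-κ)) from rfl, ← h3]
    refine integral_congr_ae (Filter.Eventually.of_forall fun v => ?_)
    simp only [smul_eq_mul, inner_neg_right]
    congr 4
    ring
  rw [h2, hfin, abs_of_nonneg (by positivity)]
  simp

theorem haar_prod : (volume : Measure (ℝ × (EuclideanSpace ℝ (Fin 2)))).IsAddHaarMeasure := by
  rw [Measure.volume_eq_prod]
  infer_instance

theorem GG_integrable (g : SchwartzMap (ℝ × (EuclideanSpace ℝ (Fin 2))) ℂ) : Integrable (GG g) := by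
  obtain ⟨G, hG⟩ := GG_schwartz g
  have := haar_prod
  rw [show GG g = G from funext hG]
  exact G.integrable

theorem GG_continuous (g : SchwartzMap (ℝ × (EuclideanSpace ℝ (Fin 2))) ℂ) : Continuous (GG g) := by
  obtain ⟨G, hG⟩ := GG_schwartz g
  have := haar_prod
  rw [show GG g = G from funext hG]
  exact G.continuous

theorem GG_integrable_mul (g : SchwartzMap (ℝ × (EuclideanSpace ℝ (Fin 2))) ℂ) :
    Integrable (fun p : ℝ × (EuclideanSpace ℝ (Fin 2)) => (p.1 : ℂ) * GG g p) := by
  obtain ⟨G, hG⟩ := GG_schwartz g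
  have := haar_prod
  rw [show GG g = G from funext hG]
  refine (G.integrable_pow_mul volume 1).mono' ?_ (Filter.Eventually.of_forall fun p => ?_)
  · have := G.continuous
    exact Continuous.aestronglyMeasurable (by fun_prop)
  · rw [norm_mul, Complex.norm_real, pow_one]
    gcongr
    exact norm_fst_le p

/-- First two coordinates. -/
noncomputable def k12 (k : (EuclideanSpace ℝ (Fin 3))) : (EuclideanSpace ℝ (Fin 2)) := (EuclideanSpace.equiv (Fin 2) ℝ).symm ![k 0, k 1]

theorem inner_emb (k : (EuclideanSpace ℝ (Fin 3))) (ξ : (EuclideanSpace ℝ (Fin 2))) : (⟪k, emb ξ 0⟫ : ℝ) = ⟪k12 k, ξ⟫ := by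
  simp [k12, emb, PiLp.inner_apply, Fin.sum_univ_three, Fin.sum_univ_two]

theorem norm_k12 (k : (EuclideanSpace ℝ (Fin 3))) : ‖k12 k‖ ≤ ‖k‖ := by
  apply le_of_sq_le_sq _ (norm_nonneg _)
  rw [EuclideanSpace.norm_sq_eq, EuclideanSpace.norm_sq_eq]
  simp [k12, Fin.sum_univ_three, Fin.sum_univ_two]
  positivity

theorem k12_continuous : Continuous k12 := by
  unfold k12
  refine (EuclideanSpace.equiv (Fin 2) ℝ).symm.continuous.comp ?_
  refine continuous_pi fun i => ?_
  fin_cases i <;> simp <;> fun_prop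

theorem Q_eq (h : SchwartzMap (EuclideanSpace ℝ (Fin 3)) ℂ) (t : ℝ) (ξ : (EuclideanSpace ℝ (Fin 2))) :
    Q h t ξ = ∫ k : (EuclideanSpace ℝ (Fin 3)), (𝓕 h) k * (Complex.exp (((2 * π * ⟪k12 k, ξ⟫ : ℝ) : ℂ) * Complex.I) *
      ((t * Real.sinc (2 * π * t * ‖k‖) : ℝ) : ℂ)) := by
  have hinv : ∀ x, h x = ∫ k : (EuclideanSpace ℝ (Fin 3)), Complex.exp (((2 * π * ⟪k, x⟫ : ℝ) : ℂ) * Complex.I) * (𝓕 h) k := by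
    intro x
    have h3 : (𝓕⁻ (𝓕 h)) x = h x := by rw [FourierTransform.fourierInv_fourier_eq]
    rw [SchwartzMap.fourierInv_coe, Real.fourierInv_eq'] at h3
    rw [← h3]
    simp
  have hpi : π ≠ 0 := Real.pi_ne_zero
  rw [Q]
  simp_rw [hinv]
  rw [integral_integral_swap, ← integral_const_mul]
  · refine integral_congr_ae (Filter.Eventually.of_forall fun k => ?_)
    have h4 : ∀ η : (Metric.sphere (0 : EuclideanSpace ℝ (Fin 3)) 1), Complex.exp (((2 * π * ⟪k, emb ξ 0 + t • (η : (EuclideanSpace ℝ (Fin 3)))⟫ : ℝ) : ℂ) * Complex.I) * (𝓕 h) k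
        = Complex.exp (((⟪(2 * π * t) • k, (η : (EuclideanSpace ℝ (Fin 3)))⟫ : ℝ) : ℂ) * Complex.I) *
          (Complex.exp (((2 * π * ⟪k12 k, ξ⟫ : ℝ) : ℂ) * Complex.I) * (𝓕 h) k) := by
      intro η
      rw [← mul_assoc, ← Complex.exp_add, inner_add_right, inner_emb, inner_smul_right, inner_smul_left]
      congr 2
      push_cast
      simp
      ring
    simp only [h4]
    rw [integral_mul_const, sphere_exp, norm_smul, Real.norm_eq_abs]
    have h5 : Real.sinc (|2 * π * t| * ‖k‖) = Real.sinc (2 * π * t * ‖k‖) := by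
      rcases abs_choice (2 * π * t) with h | h <;> rw [h]
      rw [neg_mul, Real.sinc_neg]
    rw [h5]
    have : (π : ℂ) ≠ 0 := by exact_mod_cast hpi
    push_cast
    field_simp
  · have hI : Integrable (fun x : (Metric.sphere (0 : EuclideanSpace ℝ (Fin 3)) 1) × (EuclideanSpace ℝ (Fin 3)) => (𝓕 h) x.2) ((volume : Measure (EuclideanSpace ℝ (Fin 3))).toSphere.prod volume) :=
      (𝓕 h).integrable.comp_snd _
    refine hI.mono ?_ (Filter.Eventually.of_forall fun x => ?_)
    · have := (𝓕 h).continuous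
      exact Continuous.aestronglyMeasurable (by fun_prop)
    · simp only [Function.uncurry, norm_mul, Complex.norm_exp_ofReal_mul_I, one_mul, le_refl]

theorem GG_sinc (g : SchwartzMap (ℝ × (EuclideanSpace ℝ (Fin 2))) ℂ)
    (hg : ∀ (ω : ℝ) (σ : (EuclideanSpace ℝ (Fin 2))), ‖σ‖ ≤ |ω| → g (ω, σ) = 0) (k : (EuclideanSpace ℝ (Fin 3))) (hk : k ≠ 0) :
    ∫ p : ℝ × (EuclideanSpace ℝ (Fin 2)), Complex.exp (((2 * π * ⟪k12 k, p.2⟫ : ℝ) : ℂ) * Complex.I) *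
      ((p.1 * Real.sinc (2 * π * p.1 * ‖k‖) : ℝ) : ℂ) * GG g p = 0 := by
  have hpi : π ≠ 0 := Real.pi_ne_zero
  have hk' : ‖k‖ ≠ 0 := norm_ne_zero_iff.2 hk
  have hpiC : (π : ℂ) ≠ 0 := by exact_mod_cast hpi
  have hkC : (‖k‖ : ℂ) ≠ 0 := by exact_mod_cast hk'
  have hint : ∀ (ω : ℝ) (σ : (EuclideanSpace ℝ (Fin 2))), Integrable fun p : ℝ × (EuclideanSpace ℝ (Fin 2)) =>
      Complex.exp (((ω * p.1 + ⟪σ, p.2⟫ : ℝ) : ℂ) * Complex.I) * GG g p := by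
    intro ω σ
    refine (GG_integrable g).mono ?_ (Filter.Eventually.of_forall fun x => ?_)
    · have := GG_continuous g
      exact Continuous.aestronglyMeasurable (by fun_prop)
    · simp only [norm_mul, Complex.norm_exp_ofReal_mul_I, one_mul, le_refl]
  have hz : ∀ ω : ℝ, |ω| = 2 * π * ‖k‖ → ∫ p : ℝ × (EuclideanSpace ℝ (Fin 2)),
      Complex.exp (((ω * p.1 + ⟪(2 * π) • k12 k, p.2⟫ : ℝ) : ℂ) * Complex.I) * GG g p = 0 := by
    intro ω hω
    rw [GG_vanish, hg, mul_zero]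
    rw [abs_neg, hω, norm_neg, norm_smul, Real.norm_eq_abs, abs_of_nonneg (by positivity)]
    gcongr
    exact norm_k12 k
  have hsinc : ∀ t : ℝ, t * Real.sinc (2 * π * t * ‖k‖) = Real.sin (2 * π * ‖k‖ * t) / (2 * π * ‖k‖) := by
    intro t
    by_cases ht : t = 0
    · simp [ht]
    · rw [Real.sinc_of_ne_zero (by positivity), show 2 * π * t * ‖k‖ = 2 * π * ‖k‖ * t by ring]
      field_simp
  have hrew : ∀ p : ℝ × (EuclideanSpace ℝ (Fin 2)), Complex.exp (((2 * π * ⟪k12 k, p.2⟫ : ℝ) : ℂ) * Complex.I) *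
      ((p.1 * Real.sinc (2 * π * p.1 * ‖k‖) : ℝ) : ℂ) * GG g p =
      (1 / (4 * π * ‖k‖ * Complex.I) : ℂ) *
      (Complex.exp ((((2 * π * ‖k‖) * p.1 + ⟪(2 * π) • k12 k, p.2⟫ : ℝ) : ℂ) * Complex.I) * GG g p -
       Complex.exp ((((-(2 * π * ‖k‖)) * p.1 + ⟪(2 * π) • k12 k, p.2⟫ : ℝ) : ℂ) * Complex.I) * GG g p) := by
    intro p
    rw [hsinc, inner_smul_left]
    push_cast
    rw [add_mul, add_mul, Complex.exp_add, Complex.exp_add, Complex.sin]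
    simp only [conj_trivial]
    push_cast
    field_simp
    rw [Complex.I_sq]
    ring_nf
  simp_rw [hrew]
  rw [integral_const_mul, integral_sub (hint _ _) (hint _ _), hz, hz, sub_zero, mul_zero]
  · rw [abs_neg, abs_of_nonneg (by positivity)]
  · rw [abs_of_nonneg (by positivity)]

theorem Phi_integrable (h : SchwartzMap (EuclideanSpace ℝ (Fin 3)) ℂ) (g : SchwartzMap (ℝ × (EuclideanSpace ℝ (Fin 2))) ℂ) :
    Integrable (fun x : (ℝ × (EuclideanSpace ℝ (Fin 2))) × (EuclideanSpace ℝ (Fin 3)) => (𝓕 h) x.2 *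
      (Complex.exp (((2 * π * ⟪k12 x.2, x.1.2⟫ : ℝ) : ℂ) * Complex.I) *
      ((x.1.1 * Real.sinc (2 * π * x.1.1 * ‖x.2‖) : ℝ) : ℂ)) * GG g x.1)
      ((volume : Measure (ℝ × (EuclideanSpace ℝ (Fin 2)))).prod (volume : Measure (EuclideanSpace ℝ (Fin 3)))) := by
  refine ((GG_integrable_mul g).mul_prod (𝓕 h).integrable).mono ?_
    (Filter.Eventually.of_forall fun x => ?_)
  · have h1 := GG_continuous g
    have h2 := (𝓕 h).continuous
    have h3 := k12_continuous
    have h4 := Real.continuous_sinc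
    exact Continuous.aestronglyMeasurable (by fun_prop)
  · simp only [norm_mul, Complex.norm_exp_ofReal_mul_I, one_mul, Complex.norm_real, Real.norm_eq_abs]
    have := Real.abs_sinc_le_one (2 * π * x.1.1 * ‖x.2‖)
    calc _ = (|x.1.1| * ‖GG g x.1‖ * ‖(𝓕 h) x.2‖) * |Real.sinc (2 * π * x.1.1 * ‖x.2‖)| := by ring
      _ ≤ (|x.1.1| * ‖GG g x.1‖ * ‖(𝓕 h) x.2‖) * 1 := by gcongr
      _ = _ := by rw [mul_one]

theorem main_aux (h : SchwartzMap (EuclideanSpace ℝ (Fin 3)) ℂ) (g : SchwartzMap (ℝ × (EuclideanSpace ℝ (Fin 2))) ℂ)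
    (hg : ∀ (ω : ℝ) (σ : (EuclideanSpace ℝ (Fin 2))), ‖σ‖ ≤ |ω| → g (ω, σ) = 0) :
    Integrable (fun p : ℝ × (EuclideanSpace ℝ (Fin 2)) => Q h p.1 p.2 * GG g p) ∧
    ∫ p : ℝ × (EuclideanSpace ℝ (Fin 2)), Q h p.1 p.2 * GG g p = 0 := by
  have hP := Phi_integrable h g
  have h1 : ∀ p : ℝ × (EuclideanSpace ℝ (Fin 2)), Q h p.1 p.2 * GG g p = ∫ k : (EuclideanSpace ℝ (Fin 3)), (𝓕 h) k *
      (Complex.exp (((2 * π * ⟪k12 k, p.2⟫ : ℝ) : ℂ) * Complex.I) *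
      ((p.1 * Real.sinc (2 * π * p.1 * ‖k‖) : ℝ) : ℂ)) * GG g p := by
    intro p
    rw [Q_eq, integral_mul_const]
  simp_rw [h1]
  refine ⟨hP.integral_prod_left, ?_⟩
  rw [integral_integral_swap hP]
  have hne : ∀ᵐ k : (EuclideanSpace ℝ (Fin 3)), k ≠ 0 := by
    simp [ae_iff]
  rw [← integral_zero (EuclideanSpace ℝ (Fin 3)) ℂ (μ := volume)]
  refine integral_congr_ae ?_
  filter_upwards [hne] with k hk
  simp_rw [mul_assoc ((𝓕 h) k)]
  rw [integral_const_mul, GG_sinc g hg k hk, mul_zero]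

theorem stmt14 (h : SchwartzMap (EuclideanSpace ℝ (Fin 3)) ℂ)
    (g : SchwartzMap (ℝ × EuclideanSpace ℝ (Fin 2)) ℂ)
    (hg : ∀ (ω : ℝ) (σ : EuclideanSpace ℝ (Fin 2)), ‖σ‖ ≤ |ω| → g (ω, σ) = 0) :
    Integrable (fun p : ℝ × EuclideanSpace ℝ (Fin 2) =>
        Q (⇑h) p.1 p.2 * ((((2 * π : ℝ) ^ (-(3 : ℝ) / 2) : ℝ) : ℂ) *
          ∫ q : ℝ × EuclideanSpace ℝ (Fin 2),
            g q * Complex.exp (Complex.I * ((q.1 * p.1 + ⟪q.2, p.2⟫ : ℝ) : ℂ)))) ∧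
    (∫ p : ℝ × EuclideanSpace ℝ (Fin 2),
        Q (⇑h) p.1 p.2 * ((((2 * π : ℝ) ^ (-(3 : ℝ) / 2) : ℝ) : ℂ) *
          ∫ q : ℝ × EuclideanSpace ℝ (Fin 2),
            g q * Complex.exp (Complex.I * ((q.1 * p.1 + ⟪q.2, p.2⟫ : ℝ) : ℂ)))) = 0 := by

  obtain ⟨h1, h2⟩ := main_aux h g hg
  have h3 : ∀ p : ℝ × EuclideanSpace ℝ (Fin 2),
      Q (⇑h) p.1 p.2 * ((((2 * π : ℝ) ^ (-(3 : ℝ) / 2) : ℝ) : ℂ) *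
          ∫ q : ℝ × EuclideanSpace ℝ (Fin 2),
            g q * Complex.exp (Complex.I * ((q.1 * p.1 + ⟪q.2, p.2⟫ : ℝ) : ℂ)))
      = (((2 * π : ℝ) ^ (-(3 : ℝ) / 2) : ℝ) : ℂ) * (Q h p.1 p.2 * GG g p) := by
    intro p
    rw [GG]
    ring
  simp_rw [h3]
  refine ⟨h1.const_mul _, ?_⟩
  rw [integral_const_mul, h2, mul_zero]
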